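/- arXiv:1408.2320 — 2 statements merged into one kernel-verified Lean document; each statement's English description precedes it below -/
import Mathlib

section
/- Let t₀ be a real-valued random variable with cumulative distribution function F_{t₀}, let 0 ≤ c < d, and let T be a random variable uniformly distributed on the interval [c, d), independent of t₀. Let a > 0 and x(t) = a·𝟙{t₀ ≤ t < t₀ + T}. Then for every t ∈ ℝ, E[x(t)] = a · ( F_{t₀}(t) − (1/(d − c)) · ∫_c^d F_{t₀}(t − s) ds ). -/
open MeasureTheory

/-- If `T` is uniform on `[c, d)` (with `0 ≤ c < d`) and independent
of `t₀` with CDF `F_{t₀}`, then for `x(t) = a·𝟙{t₀ ≤ t < t₀ + T}` with `a > 0`,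
`E[x(t)] = a · (F_{t₀}(t) − (1/(d − c)) ∫_c^d F_{t₀}(t − s) ds)`. -/
theorem expected_demand_uniform_charging_time
    {Ω : Type*} [MeasurableSpace Ω] (P : Measure Ω) [IsProbabilityMeasure P]
    (t₀ T : Ω → ℝ) (ht₀ : Measurable t₀) (hT : Measurable T)
    (hIndep : ProbabilityTheory.IndepFun t₀ T P)
    (c d : ℝ) (hc : 0 ≤ c) (hcd : c < d)
    (hunif : P.map T = (ENNReal.ofReal (d - c))⁻¹ • volume.restrict (Set.Ico c d))
    (F : ℝ → ℝ) (hF : ∀ x, F x = (P {ω : Ω | t₀ ω ≤ x}).toReal)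
    (a : ℝ) (ha : 0 < a) (t : ℝ) :
    (∫ ω, Set.indicator {ω : Ω | t₀ ω ≤ t ∧ t < t₀ ω + T ω} (fun _ => a) ω ∂P)
      = a * (F t - (1 / (d - c)) * ∫ s in c..d, F (t - s)) := by
  have hA : MeasurableSet {ω : Ω | t₀ ω ≤ t} := measurableSet_le ht₀ measurable_const
  have hB : MeasurableSet {ω : Ω | t₀ ω + T ω ≤ t} :=
    measurableSet_le (ht₀.add hT) measurable_const
  have hTnn : ∀ᵐ ω ∂P, 0 ≤ T ω := by
    have h1 : ∀ᵐ s ∂(P.map T), 0 ≤ s := by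
      rw [hunif]
      apply Measure.ae_smul_measure
      filter_upwards [ae_restrict_mem measurableSet_Ico] with s hs
      exact hc.trans hs.1
    exact ae_of_ae_map hT.aemeasurable h1
  have hset : {ω : Ω | t₀ ω ≤ t ∧ t < t₀ ω + T ω}
      = {ω : Ω | t₀ ω ≤ t} \ {ω : Ω | t₀ ω + T ω ≤ t} := by
    ext ω
    simp
  have hinter : P.real ({ω : Ω | t₀ ω ≤ t} ∩ {ω : Ω | t₀ ω + T ω ≤ t})
      = P.real {ω : Ω | t₀ ω + T ω ≤ t} := by
    apply measureReal_congr
    filter_upwards [hTnn] with ω hω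
    apply propext
    show (t₀ ω ≤ t ∧ t₀ ω + T ω ≤ t) ↔ (t₀ ω + T ω ≤ t)
    exact ⟨fun h => h.2, fun h => ⟨by linarith, h⟩⟩
  have hmono : Monotone F := by
    intro x y hxy
    rw [hF, hF]
    exact ENNReal.toReal_mono (measure_ne_top _ _)
      (measure_mono fun ω (h : t₀ ω ≤ x) => h.trans hxy)
  have hPB : P.real {ω : Ω | t₀ ω + T ω ≤ t} = (1 / (d - c)) * ∫ s in c..d, F (t - s) := by
    have hS : MeasurableSet {p : ℝ × ℝ | p.1 + p.2 ≤ t} :=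
      measurableSet_le (measurable_fst.add measurable_snd) measurable_const
    have hmap := (ProbabilityTheory.indepFun_iff_map_prod_eq_prod_map_map
      ht₀.aemeasurable hT.aemeasurable).1 hIndep
    have : IsProbabilityMeasure (P.map t₀) := Measure.isProbabilityMeasure_map ht₀.aemeasurable
    have : IsProbabilityMeasure (P.map T) := Measure.isProbabilityMeasure_map hT.aemeasurable
    have h1 : P {ω : Ω | t₀ ω + T ω ≤ t}
        = (P.map (fun ω => (t₀ ω, T ω))) {p : ℝ × ℝ | p.1 + p.2 ≤ t} := by
      rw [Measure.map_apply (ht₀.prodMk hT) hS]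
      rfl
    have h2 : ∀ s, (P.map t₀) ((fun x => (x, s)) ⁻¹' {p : ℝ × ℝ | p.1 + p.2 ≤ t})
        = ENNReal.ofReal (F (t - s)) := by
      intro s
      rw [Measure.map_apply ht₀ (measurable_prodMk_right hS), hF,
        ENNReal.ofReal_toReal (measure_ne_top _ _)]
      congr 1
      ext ω
      simp [le_sub_iff_add_le]
    rw [measureReal_def, h1, hmap, Measure.prod_apply_symm hS]
    simp_rw [h2]
    rw [hunif, lintegral_smul_measure, smul_eq_mul, ENNReal.toReal_mul, ENNReal.toReal_inv,
      ENNReal.toReal_ofReal (by linarith), one_div,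
      intervalIntegral.integral_of_le hcd.le, ← integral_Ico_eq_integral_Ioc,
      integral_eq_lintegral_of_nonneg_ae]
    · exact Filter.Eventually.of_forall fun s => by
        simp only [Pi.zero_apply, hF]
        exact ENNReal.toReal_nonneg
    · exact (hmono.measurable.comp (measurable_const.sub measurable_id)).aestronglyMeasurable
  rw [integral_indicator_const _ (hset ▸ hA.diff hB), hset, ← hPB, hF t, smul_eq_mul, mul_comm]
  congr 1
  have h3 := measureReal_inter_add_sdiff (μ := P) (s := {ω : Ω | t₀ ω ≤ t}) hB
  rw [hinter] at h3
  rw [← measureReal_def]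
  linarith
end

section
/- Let t₀ be normally distributed with mean μ ∈ ℝ and variance σ² (σ > 0), let 0 ≤ c < d, and let T be uniformly distributed on [c, d), independent of t₀. Let a > 0 and x(t) = a·𝟙{t₀ ≤ t < t₀ + T}. Define Q(x) = (1/√(2π)) ∫_x^∞ exp(−u²/2) du and f(x) = exp(−x²/2)/√(2π). Then for every t ∈ ℝ, setting c′ = (t − c − μ)/σ and d′ = (t − d − μ)/σ, one has E[x(t)] = a · [ 1 − Q((t − μ)/σ) + (σ/(d − c)) · ( c′·Q(c′) − d′·Q(d′) + f(d′) − f(c′) + d′ − c′ ) ]. -/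
open MeasureTheory

/-- The standard Gaussian tail function `Q(x) = (1/√(2π)) ∫_x^∞ exp(−u²/2) du`. -/
noncomputable def gaussQ (x : ℝ) : ℝ :=
  (1 / Real.sqrt (2 * Real.pi)) * ∫ u in Set.Ioi x, Real.exp (-u ^ 2 / 2)

/-- The standard Gaussian density `f(x) = exp(−x²/2)/√(2π)`. -/
noncomputable def gaussPdf (x : ℝ) : ℝ :=
  Real.exp (-x ^ 2 / 2) / Real.sqrt (2 * Real.pi)

lemma aux_integrable : Integrable (fun u : ℝ => Real.exp (-u ^ 2 / 2)) := by
  have h := integrable_exp_neg_mul_sq (b := 1 / 2) (by norm_num)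
  refine h.congr (Filter.Eventually.of_forall fun x => ?_)
  show Real.exp _ = Real.exp _
  congr 1
  ring

lemma aux_gaussQ_deriv (x : ℝ) : HasDerivAt gaussQ (-gaussPdf x) x := by
  have hcont : Continuous (fun u : ℝ => Real.exp (-u ^ 2 / 2)) := by fun_prop
  have h1 := (hcont.integral_hasStrictDerivAt 0 x).hasDerivAt
  have h2 : gaussQ = fun y => (1 / Real.sqrt (2 * Real.pi)) *
      ((∫ u in Set.Ioi 0, Real.exp (-u ^ 2 / 2)) - ∫ u in (0 : ℝ)..y, Real.exp (-u ^ 2 / 2)) := by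
    funext y
    have := intervalIntegral.integral_interval_add_Ioi (a := 0) (b := y)
      aux_integrable.integrableOn aux_integrable.integrableOn
    rw [gaussQ, ← this]
    ring
  rw [h2]
  refine ((h1.const_sub _).const_mul (1 / Real.sqrt (2 * Real.pi))).congr_deriv ?_
  rw [gaussPdf]
  ring

lemma aux_gaussPdf_deriv (x : ℝ) : HasDerivAt gaussPdf (-x * gaussPdf x) x := by
  have h1 : HasDerivAt (fun y : ℝ => -y ^ 2 / 2) (-x) x := by
    refine (((hasDerivAt_pow 2 x).neg).div_const 2).congr_deriv ?_
    norm_num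
    ring
  refine ((h1.exp).div_const (Real.sqrt (2 * Real.pi))).congr_deriv ?_
  rw [gaussPdf]
  ring

lemma aux_anti (x : ℝ) : HasDerivAt (fun y => y * gaussQ y - gaussPdf y) (gaussQ x) x := by
  refine (((hasDerivAt_id x).mul (aux_gaussQ_deriv x)).sub (aux_gaussPdf_deriv x)).congr_deriv ?_
  simp only [id]
  ring

lemma aux_std (x : ℝ) : (ProbabilityTheory.gaussianReal 0 1).real (Set.Ioi x) = gaussQ x := by
  rw [Measure.real, ProbabilityTheory.gaussianReal_apply_eq_integral _ one_ne_zero,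
    ENNReal.toReal_ofReal
      (integral_nonneg fun u => ProbabilityTheory.gaussianPDFReal_nonneg _ _ _)]
  simp only [ProbabilityTheory.gaussianPDFReal, integral_const_mul, gaussQ]
  simp

lemma aux_gauss (μ σ : ℝ) (hσ : 0 < σ) (x : ℝ) :
    (ProbabilityTheory.gaussianReal μ ⟨σ ^ 2, sq_nonneg σ⟩).real (Set.Ioi x)
      = gaussQ ((x - μ) / σ) := by
  have h1 := ProbabilityTheory.gaussianReal_map_const_mul (μ := 0) (v := 1) σ
  have h2 := ProbabilityTheory.gaussianReal_map_add_const (μ := σ * 0)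
    (v := NNReal.mk (σ ^ 2) (sq_nonneg σ) * 1) μ
  rw [← h1, mul_one, mul_zero, zero_add] at h2
  change _ = ProbabilityTheory.gaussianReal μ ⟨σ ^ 2, sq_nonneg σ⟩ at h2
  rw [← h2, map_measureReal_apply (by fun_prop) measurableSet_Ioi,
    map_measureReal_apply (by fun_prop) (measurableSet_Ioi.preimage (by fun_prop)), ← aux_std]
  congr 1
  ext u
  simp only [Set.mem_preimage, Set.mem_Ioi]
  rw [div_lt_iff₀ hσ]
  constructor <;> intro h <;> linarith

/-- If `t₀ ~ N(μ, σ²)` and `T` is uniform on `[c, d)` (with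
`0 ≤ c < d`), independent of `t₀`, then for `x(t) = a·𝟙{t₀ ≤ t < t₀ + T}` with `a > 0`,
setting `c′ = (t − c − μ)/σ` and `d′ = (t − d − μ)/σ`,
`E[x(t)] = a·[1 − Q((t−μ)/σ) + (σ/(d−c))(c′Q(c′) − d′Q(d′) + f(d′) − f(c′) + d′ − c′)]`. -/
theorem expected_demand_gaussian_arrival_uniform_charging
    {Ω : Type*} [MeasurableSpace Ω] (P : Measure Ω) [IsProbabilityMeasure P]
    (t₀ T : Ω → ℝ) (ht₀ : Measurable t₀) (hT : Measurable T)
    (hIndep : ProbabilityTheory.IndepFun t₀ T P)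
    (μ σ : ℝ) (hσ : 0 < σ)
    (hgauss : P.map t₀ = ProbabilityTheory.gaussianReal μ ⟨σ ^ 2, sq_nonneg σ⟩)
    (c d : ℝ) (hc : 0 ≤ c) (hcd : c < d)
    (hunif : P.map T = (ENNReal.ofReal (d - c))⁻¹ • volume.restrict (Set.Ico c d))
    (a : ℝ) (ha : 0 < a) (t : ℝ) :
    (∫ ω, Set.indicator {ω : Ω | t₀ ω ≤ t ∧ t < t₀ ω + T ω} (fun _ => a) ω ∂P)
      = a * (1 - gaussQ ((t - μ) / σ) + (σ / (d - c)) *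
          (((t - c - μ) / σ) * gaussQ ((t - c - μ) / σ)
            - ((t - d - μ) / σ) * gaussQ ((t - d - μ) / σ)
            + gaussPdf ((t - d - μ) / σ) - gaussPdf ((t - c - μ) / σ)
            + (t - d - μ) / σ - (t - c - μ) / σ)) := by
  have hQc : Continuous gaussQ :=
    continuous_iff_continuousAt.2 fun x => (aux_gaussQ_deriv x).continuousAt
  set S : Set (ℝ × ℝ) := {p | p.1 ≤ t ∧ t < p.1 + p.2} with hS
  have hSm : MeasurableSet S :=
    (measurableSet_le measurable_fst measurable_const).inter
      (measurableSet_lt measurable_const (measurable_fst.add measurable_snd))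
  have hpm : Measurable fun ω => (t₀ ω, T ω) := ht₀.prodMk hT
  have hjoint := (ProbabilityTheory.indepFun_iff_map_prod_eq_prod_map_map
    ht₀.aemeasurable hT.aemeasurable).1 hIndep
  haveI : IsProbabilityMeasure (P.map T) := Measure.isProbabilityMeasure_map hT.aemeasurable
  haveI : IsProbabilityMeasure (P.map t₀) := Measure.isProbabilityMeasure_map ht₀.aemeasurable
  have e1 : (∫ ω, Set.indicator {ω : Ω | t₀ ω ≤ t ∧ t < t₀ ω + T ω} (fun _ => a) ω ∂P)
      = ∫ p, S.indicator (fun _ => a) p ∂((P.map t₀).prod (P.map T)) := by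
    rw [← hjoint, integral_map hpm.aemeasurable
      (measurable_const.indicator hSm).aestronglyMeasurable]
    rfl
  have e2 : ∀ s ∈ Set.Ico c d, (∫ r, S.indicator (fun _ => a) (r, s) ∂(P.map t₀))
      = a * (gaussQ ((t - s - μ) / σ) - gaussQ ((t - μ) / σ)) := by
    intro s hs
    have hs0 : 0 ≤ s := hc.trans hs.1
    have : (fun r => S.indicator (fun _ => a) (r, s))
        = (Set.Ioi (t - s) \ Set.Ioi t).indicator (fun _ => a) := by
      funext r
      by_cases h : r ≤ t ∧ t < r + s
      · rw [Set.indicator_of_mem (show (r, s) ∈ S from h), Set.indicator_of_mem]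
        exact ⟨by simp only [Set.mem_Ioi]; linarith [h.2], by simpa using h.1⟩
      · rw [Set.indicator_of_notMem (show (r, s) ∉ S from h), Set.indicator_of_notMem]
        rintro ⟨h1, h2⟩
        simp only [Set.mem_Ioi, not_lt] at h1 h2
        exact h ⟨h2, by linarith⟩
    rw [this, integral_indicator_const _ (measurableSet_Ioi.diff measurableSet_Ioi),
      measureReal_sdiff (Set.Ioi_subset_Ioi (by linarith)) measurableSet_Ioi, hgauss,
      aux_gauss μ σ hσ, aux_gauss μ σ hσ, smul_eq_mul, mul_comm]
  have e3 : (∫ s in c..d, gaussQ ((t - s - μ) / σ))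
      = -σ * (((t - d - μ) / σ) * gaussQ ((t - d - μ) / σ) - gaussPdf ((t - d - μ) / σ))
        - -σ * (((t - c - μ) / σ) * gaussQ ((t - c - μ) / σ) - gaussPdf ((t - c - μ) / σ)) := by
    refine intervalIntegral.integral_eq_sub_of_hasDerivAt
      (f := fun s => -σ * (((t - s - μ) / σ) * gaussQ ((t - s - μ) / σ)
        - gaussPdf ((t - s - μ) / σ))) (fun s _ => ?_) ?_
    · have hin : HasDerivAt (fun s : ℝ => (t - s - μ) / σ) (-1 / σ) s :=
        (((hasDerivAt_id s).const_sub t).sub_const μ).div_const σ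
      refine (((aux_anti ((t - s - μ) / σ)).comp s hin).const_mul (-σ)).congr_deriv ?_
      field_simp
    · exact (hQc.comp (by fun_prop)).intervalIntegrable _ _
  have hi : IntervalIntegrable (fun s => gaussQ ((t - s - μ) / σ)) volume c d :=
    (hQc.comp (by fun_prop)).intervalIntegrable _ _
  have hdc : 0 < d - c := sub_pos.2 hcd
  rw [e1, integral_prod_symm _ ((integrable_const a).indicator hSm), hunif, integral_smul_measure,
    setIntegral_congr_fun measurableSet_Ico e2, integral_Ico_eq_integral_Ioc,
    ← intervalIntegral.integral_of_le hcd.le, intervalIntegral.integral_const_mul,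
    intervalIntegral.integral_sub hi (by simp), e3, intervalIntegral.integral_const,
    ENNReal.toReal_inv, ENNReal.toReal_ofReal hdc.le]
  simp only [smul_eq_mul]
  have hne : d - c ≠ 0 := hdc.ne'
  generalize gaussQ ((t - d - μ) / σ) = q1
  generalize gaussQ ((t - c - μ) / σ) = q2
  generalize gaussPdf ((t - d - μ) / σ) = f1
  generalize gaussPdf ((t - c - μ) / σ) = f2
  generalize gaussQ ((t - μ) / σ) = q3
  field_simp
  ring
end
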